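/- The class of summary graphs is stable under marginalisation and conditioning: for every summary graph G with node set V and all disjoint subsets M, C of V, there exists a summary graph H with node set V∖(M∪C) such that J_m(H) = α(J_m(G);M,C). -/

import Mathlib

/-!
Stable mixed graphs: mixed graphs with arrows, arcs and lines; ribbonless,
summary and ancestral graphs; the generating maps α_RG, α_SG, α_AG;
m-connecting paths, m-separation and induced independence models.
-/

namespace StableMixedGraphs

/-- A mixed graph on node type `V`: a node set together with three edge
relations: arrows (`arrow i j` means an arrow from `i` to `j`), arcs
(two-headed, symmetric) and lines (undirected, symmetric). -/
structure MixedGraph (V : Type) where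
  nodes : Set V
  arrow : V → V → Prop
  arc : V → V → Prop
  line : V → V → Prop

namespace MixedGraph

variable {V W : Type}

/-- Wellformedness: arcs and lines are symmetric relations and all edges join
nodes of the graph. -/
def Wf (G : MixedGraph V) : Prop :=
  (∀ i j, G.arc i j → G.arc j i) ∧
  (∀ i j, G.line i j → G.line j i) ∧
  (∀ i j, G.arrow i j ∨ G.arc i j ∨ G.line i j → i ∈ G.nodes ∧ j ∈ G.nodes)

/-- No loops of any of the three kinds. -/
def Loopless (G : MixedGraph V) : Prop :=
  ∀ i, ¬ G.arrow i i ∧ ¬ G.arc i i ∧ ¬ G.line i i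

/-- A loopless mixed graph with a finite node set. -/
def IsLMG (G : MixedGraph V) : Prop := G.Wf ∧ G.Loopless ∧ G.nodes.Finite

/-- `G.anc i j` : `i` is an ancestor of `j`, i.e. there is a
direction-preserving path from `i` to `j`. -/
def anc (G : MixedGraph V) (i j : V) : Prop := Relation.TransGen G.arrow i j

/-- The set of ancestors of nodes of `C`. -/
def anSet (G : MixedGraph V) (C : Set V) : Set V := {a | ∃ c ∈ C, G.anc a c}

/-- `i` lies on a direction-preserving cycle. -/
def OnDPCycle (G : MixedGraph V) (i : V) : Prop := G.anc i i

/-- `i` is an endpoint of a line. -/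
def LineEndpoint (G : MixedGraph V) (i : V) : Prop := ∃ j, G.line i j

/-- Condition (2) of a ribbon: `i` or a descendant of `i` is an endpoint of a
line or lies on a direction-preserving cycle. -/
def RibbonTail (G : MixedGraph V) (i : V) : Prop :=
  ∃ d, (d = i ∨ G.anc i d) ∧ (G.LineEndpoint d ∨ G.OnDPCycle d)

/-- `G` contains a ribbon: a collider V-configuration `⟨h,i,j⟩` with no
endpoint-identical edge between `h` and `j`, whose inner node `i` (or a
descendant of it) is an endpoint of a line or on a direction-preserving
cycle. -/
def HasRibbon (G : MixedGraph V) : Prop :=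
  ∃ h i j, h ≠ i ∧ i ≠ j ∧ h ≠ j ∧ G.RibbonTail i ∧
    ((G.arc h i ∧ G.arc i j ∧ ¬ G.arc h j) ∨
     (G.arrow h i ∧ G.arrow j i ∧ ¬ G.line h j) ∨
     (G.arrow h i ∧ G.arc i j ∧ ¬ G.arrow h j))

/-- A ribbonless graph: a loopless mixed graph with no ribbon. -/
def IsRG (G : MixedGraph V) : Prop := G.IsLMG ∧ ¬ G.HasRibbon

/-- A directed acyclic graph: only arrows, no direction-preserving cycle. -/
def IsDAG (G : MixedGraph V) : Prop :=
  G.IsLMG ∧ (∀ i j, ¬ G.arc i j) ∧ (∀ i j, ¬ G.line i j) ∧ ∀ i, ¬ G.anc i i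

/-- A summary graph: a loopless mixed graph with no arrowhead pointing to an
endpoint of a line and no direction-preserving cycle. -/
def IsSG (G : MixedGraph V) : Prop :=
  G.IsLMG ∧ (∀ i, G.LineEndpoint i → ∀ k, ¬ G.arrow k i ∧ ¬ G.arc k i) ∧
    ∀ i, ¬ G.anc i i

/-- A simple mixed graph: no loops and no multiple edges. -/
def Simple (G : MixedGraph V) : Prop :=
  G.Loopless ∧ ∀ i j,
    (G.arrow i j → ¬ G.arrow j i ∧ ¬ G.arc i j ∧ ¬ G.line i j) ∧
    (G.arc i j → ¬ G.line i j)

/-- An ancestral graph: a simple mixed graph such that no node is an ancestor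
of one of its parents or spouses, and a node with a neighbour has neither
parents nor spouses. -/
def IsAG (G : MixedGraph V) : Prop :=
  G.Wf ∧ G.Simple ∧ G.nodes.Finite ∧
  (∀ i j, G.arrow j i ∨ G.arc j i → ¬ G.anc i j) ∧
  (∀ i, G.LineEndpoint i → ∀ k, ¬ G.arrow k i ∧ ¬ G.arc k i)

/-- An undirected graph: only lines. -/
def IsUG (G : MixedGraph V) : Prop :=
  G.IsLMG ∧ (∀ i j, ¬ G.arrow i j) ∧ ∀ i j, ¬ G.arc i j

/-- A bidirected graph: only arcs. -/
def IsBG (G : MixedGraph V) : Prop :=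
  G.IsLMG ∧ (∀ i j, ¬ G.arrow i j) ∧ ∀ i j, ¬ G.line i j

/-- Image of a mixed graph under a map of node types. -/
def map (f : V → W) (G : MixedGraph V) : MixedGraph W where
  nodes := f '' G.nodes
  arrow a b := ∃ i j, G.arrow i j ∧ f i = a ∧ f j = b
  arc a b := ∃ i j, G.arc i j ∧ f i = a ∧ f j = b
  line a b := ∃ i j, G.line i j ∧ f i = a ∧ f j = b

end MixedGraph

/-! ### The closure generating new edges (Table 1 of the RG-generating
algorithm), for given marginalisation set `M` and collider set
`S = C ∪ an(C)`.  For every V-configuration whose inner node is a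
non-collider in `M` (rows 1–7) or a collider in `S` (rows 8–10) the
endpoint-identical edge between the endpoints is generated, repeatedly
until closure. -/

mutual
  /-- Generated arrows (`GenArrow H M S j i`: arrow from `j` to `i`). -/
  inductive GenArrow {V : Type} (H : MixedGraph V) (M S : Set V) : V → V → Prop
    | base {i j : V} : H.arrow i j → GenArrow H M S i j
    | row1 {i j m : V} : m ∈ M → j ≠ i →
        GenArrow H M S j m → GenArrow H M S m i → GenArrow H M S j i
    | row2 {i j m : V} : m ∈ M → j ≠ i →
        GenLine H M S j m → GenArrow H M S m i → GenArrow H M S j i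
    | row3 {i j m : V} : m ∈ M → j ≠ i →
        GenLine H M S j m → GenArc H M S m i → GenArrow H M S j i
    | row8 {i j s : V} : s ∈ S → j ≠ i →
        GenArrow H M S j s → GenArc H M S s i → GenArrow H M S j i

  /-- Generated arcs. -/
  inductive GenArc {V : Type} (H : MixedGraph V) (M S : Set V) : V → V → Prop
    | base {i j : V} : H.arc i j → GenArc H M S i j
    | symm {i j : V} : GenArc H M S i j → GenArc H M S j i
    | row4 {i j m : V} : m ∈ M → i ≠ j →
        GenArrow H M S m i → GenArrow H M S m j → GenArc H M S i j
    | row5 {i j m : V} : m ∈ M → i ≠ j →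
        GenArrow H M S m i → GenArc H M S m j → GenArc H M S i j
    | row9 {i j s : V} : s ∈ S → i ≠ j →
        GenArc H M S i s → GenArc H M S s j → GenArc H M S i j

  /-- Generated lines. -/
  inductive GenLine {V : Type} (H : MixedGraph V) (M S : Set V) : V → V → Prop
    | base {i j : V} : H.line i j → GenLine H M S i j
    | symm {i j : V} : GenLine H M S i j → GenLine H M S j i
    | row6 {i j m : V} : m ∈ M → i ≠ j →
        GenLine H M S i m → GenArrow H M S j m → GenLine H M S i j
    | row7 {i j m : V} : m ∈ M → i ≠ j →
        GenLine H M S i m → GenLine H M S m j → GenLine H M S i j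
    | row10 {i j s : V} : s ∈ S → i ≠ j →
        GenArrow H M S i s → GenArrow H M S j s → GenLine H M S i j
end

variable {V : Type}

/-- The RG-generating map `α_RG(H;M,C)`: generate all edges of the closure
and delete the nodes of `M ∪ C`. -/
def alphaRG (H : MixedGraph V) (M C : Set V) : MixedGraph V where
  nodes := H.nodes \ (M ∪ C)
  arrow i j := i ∈ H.nodes \ (M ∪ C) ∧ j ∈ H.nodes \ (M ∪ C) ∧
    GenArrow H M (C ∪ H.anSet C) i j
  arc i j := i ∈ H.nodes \ (M ∪ C) ∧ j ∈ H.nodes \ (M ∪ C) ∧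
    GenArc H M (C ∪ H.anSet C) i j
  line i j := i ∈ H.nodes \ (M ∪ C) ∧ j ∈ H.nodes \ (M ∪ C) ∧
    GenLine H M (C ∪ H.anSet C) i j

/-- The arrowhead-removal operation `α_RG.SG(K;A)`: every arrowhead pointing
at a node of `A` is removed (an arrow at such a node becomes a line, an arc
becomes an arrow, an arc with both endpoints in `A` becomes a line),
repeatedly until closure. -/
def deheadAt (K : MixedGraph V) (A : Set V) : MixedGraph V where
  nodes := K.nodes
  arrow j i := i ∉ A ∧ (K.arrow j i ∨ (K.arc j i ∧ j ∈ A))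
  arc i j := K.arc i j ∧ i ∉ A ∧ j ∉ A
  line i j := K.line i j ∨ (K.arrow j i ∧ i ∈ A) ∨ (K.arrow i j ∧ j ∈ A) ∨
    (K.arc i j ∧ i ∈ A ∧ j ∈ A)

/-- The SG-generating map `α_SG(H;M,C)`: mark the nodes of `an(C)`, apply the
RG-generating construction, then remove all arrowheads pointing at marked
nodes. -/
def alphaSG (H : MixedGraph V) (M C : Set V) : MixedGraph V :=
  deheadAt (alphaRG H M C) (H.anSet C)

/-! ### Step 2 of the AG-generating algorithm: for every V-configuration
`j → k ↔ i` or `j ↔ k ↔ i` with `k ∈ an(i)` (in the current graph) generate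
an arrow from `j` to `i`, respectively an arc between `j` and `i`, until
closure. -/

mutual
  inductive AG2Arrow {V : Type} (K : MixedGraph V) : V → V → Prop
    | base {i j : V} : K.arrow j i → AG2Arrow K j i
    | gen {i j k : V} : j ≠ i → AG2Arrow K j k → AG2Arc K k i →
        AG2Anc K k i → AG2Arrow K j i

  inductive AG2Arc {V : Type} (K : MixedGraph V) : V → V → Prop
    | base {i j : V} : K.arc i j → AG2Arc K i j
    | symm {i j : V} : AG2Arc K i j → AG2Arc K j i
    | gen {i j k : V} : j ≠ i → AG2Arc K j k → AG2Arc K k i →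
        AG2Anc K k i → AG2Arc K j i

  /-- The ancestor relation of the graph being generated in step 2. -/
  inductive AG2Anc {V : Type} (K : MixedGraph V) : V → V → Prop
    | single {i j : V} : AG2Arrow K i j → AG2Anc K i j
    | tail {i k j : V} : AG2Arrow K i k → AG2Anc K k j → AG2Anc K i j
end

/-- The graph after step 2 of the AG-generating algorithm. -/
def ag2 (K : MixedGraph V) : MixedGraph V where
  nodes := K.nodes
  arrow := AG2Arrow K
  arc := AG2Arc K
  line := K.line

/-! ### Step 3 of the AG-generating algorithm: repeatedly replace every arc
between `j` and `i` with `j ∈ an(i)` (in the current graph) by an arrow from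
`j` to `i`. -/

mutual
  inductive AG3Arrow {V : Type} (K : MixedGraph V) : V → V → Prop
    | base {i j : V} : K.arrow j i → AG3Arrow K j i
    | conv {i j : V} : K.arc j i → AG3Anc K j i → AG3Arrow K j i

  /-- The ancestor relation of the graph being generated in step 3. -/
  inductive AG3Anc {V : Type} (K : MixedGraph V) : V → V → Prop
    | single {i j : V} : AG3Arrow K i j → AG3Anc K i j
    | tail {i k j : V} : AG3Arrow K i k → AG3Anc K k j → AG3Anc K i j
end

/-- Steps 2 and 3 of the AG-generating algorithm, applied to a summary
graph: `α_SG.AG`. -/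
def alphaSGAG (K : MixedGraph V) : MixedGraph V :=
  let K2 := ag2 K
  { nodes := K.nodes
    arrow := AG3Arrow K2
    arc := fun i j => K2.arc i j ∧ ¬ AG3Anc K2 i j ∧ ¬ AG3Anc K2 j i
    line := K.line }

/-- The AG-generating map `α_AG(H;M,C)`. -/
def alphaAG (H : MixedGraph V) (M C : Set V) : MixedGraph V :=
  alphaSGAG (alphaSG H M C)

/-! ### Paths, m-connection and m-separation. -/

/-- A step of a walk: it goes from `src` to `tgt` along an edge which has an
arrowhead at `src` iff `hs = true` and an arrowhead at `tgt` iff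
`ht = true` (so `hs = ht = false` is a line, `hs = ht = true` an arc, and
exactly one head an arrow in the corresponding direction). -/
structure Step (V : Type) where
  src : V
  tgt : V
  hs : Bool
  ht : Bool

/-- The edge of a step is present in `G`. -/
def Step.valid (G : MixedGraph V) (s : Step V) : Prop :=
  match s.hs, s.ht with
  | false, false => G.line s.src s.tgt
  | false, true  => G.arrow s.src s.tgt
  | true,  false => G.arrow s.tgt s.src
  | true,  true  => G.arc s.src s.tgt

/-- `w` is a path from `i` to `j` in `G`: a nonempty chained list of valid
steps with no repeated nodes. -/
def IsPath (G : MixedGraph V) (i j : V) (w : List (Step V)) : Prop :=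
  w ≠ [] ∧ (∀ s ∈ w, s.valid G) ∧ List.Chain' (fun a b => a.tgt = b.src) w ∧
    w.head?.map Step.src = some i ∧ w.getLast?.map Step.tgt = some j ∧
    (i :: w.map Step.tgt).Nodup

/-- The path `w` is m-connecting given `M` and `C`: every inner collider node
is in `C ∪ an(C)` and every inner non-collider node is in `M`. -/
def MConnPath (G : MixedGraph V) (M C : Set V) (w : List (Step V)) : Prop :=
  List.Chain'
    (fun a b =>
      (a.ht = true ∧ b.hs = true → a.tgt ∈ C ∪ G.anSet C) ∧
      (¬ (a.ht = true ∧ b.hs = true) → a.tgt ∈ M)) w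

/-- `A ⊥_m B | C` in `G` : there is no m-connecting path between `A` and `B`
given `C` (with `M` the remaining nodes). -/
def MSep (G : MixedGraph V) (A B C : Set V) : Prop :=
  ∀ i ∈ A, ∀ j ∈ B, ∀ w : List (Step V),
    IsPath G i j w → ¬ MConnPath G (G.nodes \ (A ∪ B ∪ C)) C w

/-- The independence model induced by `G` via m-separation: the set of
triples `⟨A,B|C⟩` of pairwise disjoint subsets of the nodes with
`A ⊥_m B | C`. -/
def Jm (G : MixedGraph V) : Set (Set V × Set V × Set V) :=
  {t | t.1 ⊆ G.nodes ∧ t.2.1 ⊆ G.nodes ∧ t.2.2 ⊆ G.nodes ∧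
    Disjoint t.1 t.2.1 ∧ Disjoint t.1 t.2.2 ∧ Disjoint t.2.1 t.2.2 ∧
    MSep G t.1 t.2.1 t.2.2}

/-- The independence model after marginalisation over `M` and conditioning on
`C` : `α(J;M,C)`. -/
def alphaIM (J : Set (Set V × Set V × Set V)) (M C : Set V) :
    Set (Set V × Set V × Set V) :=
  {t | (t.1, t.2.1, t.2.2 ∪ C) ∈ J ∧ (t.1 ∪ t.2.1 ∪ t.2.2) ∩ (M ∪ C) = ∅}

/-! ### Walks -/

/-- A node `t` of a walk, entered with mark `k` and left with mark `l`, is admissible: it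
satisfies `P` if it is a collider and `Q` if it is a non-collider. -/
def Passes (P Q : V → Prop) (t : V) (k l : Bool) : Prop :=
  (k = true ∧ l = true → P t) ∧ (¬ (k = true ∧ l = true) → Q t)

/-- `Walk K P Q a h w b k`: `w` is a walk in `K` from `a`, left with mark `h`, to `b`, entered
with mark `k`, whose inner colliders satisfy `P` and whose inner non-colliders satisfy `Q`. -/
inductive Walk (K : MixedGraph V) (P Q : V → Prop) :
    V → Bool → List (Step V) → V → Bool → Prop
  | single {a b : V} {h k : Bool} : Step.valid K ⟨a, b, h, k⟩ →
      Walk K P Q a h [⟨a, b, h, k⟩] b k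
  | cons {a b c : V} {h k l m : Bool} {w : List (Step V)} : Step.valid K ⟨a, b, h, k⟩ →
      Passes P Q b k l → Walk K P Q b l w c m → Walk K P Q a h (⟨a, b, h, k⟩ :: w) c m

/-- Some edge has an arrowhead pointing to `a`. -/
def HasHead (K : MixedGraph V) (a : V) : Prop := ∃ c, K.arrow c a ∨ K.arc c a

/-- No arrowhead points to an endpoint of a line. -/
def NoHeadAtLine (K : MixedGraph V) : Prop := ∀ i, K.LineEndpoint i → ¬ HasHead K i

section

variable {K : MixedGraph V} {P Q P' Q' : V → Prop} {a b c : V} {h k l m : Bool}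
  {w w' : List (Step V)} {E : Set V}

lemma Passes.symm (hp : Passes P Q a k l) : Passes P Q a l k :=
  ⟨fun e => hp.1 e.symm, fun e => hp.2 fun e' => e e'.symm⟩

lemma Passes.mono (hP : ∀ x, P x → P' x) (hQ : ∀ x, Q x → Q' x) (hp : Passes P Q a k l) :
    Passes P' Q' a k l :=
  ⟨fun e => hP _ (hp.1 e), fun e => hQ _ (hp.2 e)⟩

lemma valid_symm (hK : K.Wf) (hv : Step.valid K ⟨a, b, h, k⟩) : Step.valid K ⟨b, a, k, h⟩ := by
  cases h <;> cases k <;> simp only [Step.valid] at hv ⊢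
  · exact hK.2.1 _ _ hv
  · exact hv
  · exact hv
  · exact hK.1 _ _ hv

lemma mem_nodes_of_valid (hK : K.Wf) (hv : Step.valid K ⟨a, b, h, k⟩) :
    a ∈ K.nodes ∧ b ∈ K.nodes := by
  cases h <;> cases k <;> simp only [Step.valid] at hv
  · exact hK.2.2 _ _ (.inr (.inr hv))
  · exact hK.2.2 _ _ (.inl hv)
  · exact (hK.2.2 _ _ (.inl hv)).symm
  · exact hK.2.2 _ _ (.inr (.inl hv))

lemma hasHead_of_valid (hv : Step.valid K ⟨a, b, h, true⟩) : HasHead K b := by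
  cases h <;> simp only [Step.valid] at hv
  · exact ⟨a, .inl hv⟩
  · exact ⟨a, .inr hv⟩

namespace Walk

lemma append (hw : Walk K P Q a h w b k) (hp : Passes P Q b k l) (hw' : Walk K P Q b l w' c m) :
    Walk K P Q a h (w ++ w') c m := by
  induction hw with
  | single hv => exact .cons hv hp hw'
  | cons hv hq _ ih => exact .cons hv hq (ih hp hw')

lemma symm (hK : K.Wf) (hw : Walk K P Q a h w b k) : ∃ w', Walk K P Q b k w' a h := by
  induction hw with
  | single hv => exact ⟨_, .single (valid_symm hK hv)⟩
  | cons hv hp _ ih =>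
    obtain ⟨w', hw'⟩ := ih
    exact ⟨_, hw'.append hp.symm (.single (valid_symm hK hv))⟩

lemma mono (hP : ∀ x, P x → P' x) (hQ : ∀ x, Q x → Q' x) (hw : Walk K P Q a h w b k) :
    Walk K P' Q' a h w b k := by
  induction hw with
  | single hv => exact .single hv
  | cons hv hp _ ih => exact .cons hv (hp.mono hP hQ) ih

lemma mem_nodes_left (hK : K.Wf) (hw : Walk K P Q a h w b k) : a ∈ K.nodes := by
  cases hw with
  | single hv => exact (mem_nodes_of_valid hK hv).1
  | cons hv => exact (mem_nodes_of_valid hK hv).1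

lemma hasHead (hw : Walk K P Q a h w b true) : HasHead K b := by
  generalize hk : true = k at hw
  induction hw with
  | single hv => subst hk; exact hasHead_of_valid hv
  | cons _ _ _ ih => exact ih hk

lemma length_pos (hw : Walk K P Q a h w b k) : 0 < w.length := by
  cases hw <;> simp

/-- Following a walk out of a tail at `a`: either `a` is an endpoint of a line, or it is an
ancestor of a collider, or the walk is directed. -/
lemma line_or_anc (hK : NoHeadAtLine K) (hw : Walk K (· ∈ E ∪ K.anSet E) Q a false w b k) :
    K.LineEndpoint a ∨ a ∈ K.anSet E ∨ (k = true ∧ K.anc a b) := by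
  generalize hh : false = h at hw
  induction hw with
  | @single a b h k hv =>
    subst hh
    cases k
    · exact .inl ⟨_, hv⟩
    · exact .inr (.inr ⟨rfl, .single hv⟩)
  | @cons a b c h k l m w hv hp _ ih =>
    subst hh
    cases k
    · exact .inl ⟨_, hv⟩
    · have hab : K.arrow a b := hv
      cases l
      · rcases ih rfl with hl | ⟨e, he, hbe⟩ | ⟨hm, hbc⟩
        · exact absurd ⟨a, .inl hab⟩ (hK b hl)
        · exact .inr (.inl ⟨e, he, .head hab hbe⟩)
        · exact .inr (.inr ⟨hm, .head hab hbc⟩)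
      · rcases hp.1 ⟨rfl, rfl⟩ with hb | ⟨e, he, hbe⟩
        · exact .inr (.inl ⟨b, hb, .single hab⟩)
        · exact .inr (.inl ⟨e, he, .head hab hbe⟩)

/-- A node outside `E` that is an ancestor of `E` is joined to `E` by a directed walk whose
inner nodes avoid `E`. -/
lemma exists_of_anc (hab : K.anc a b) (hb : b ∈ E) :
    ∃ e ∈ E, ∃ w, Walk K P (· ∉ E) a false w e true := by
  induction hab using Relation.TransGen.head_induction_on with
  | @single a hab => exact ⟨b, hb, _, .single (h := false) (k := true) hab⟩
  | @head a c hac _ ih =>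
    by_cases hc : c ∈ E
    · exact ⟨c, hc, _, .single (h := false) (k := true) hac⟩
    · obtain ⟨e, he, w, hw⟩ := ih
      exact ⟨e, he, _, .cons (h := false) (k := true) hac ⟨by simp, fun _ => hc⟩ hw⟩

/-- Colliders that are ancestors of `E` may be replaced by detours to `E`. -/
lemma detour (hK : K.Wf) (hw : Walk K (· ∈ E ∪ K.anSet E) (· ∉ E) a h w b k) :
    ∃ w', Walk K (· ∈ E) (· ∉ E) a h w' b k := by
  induction hw with
  | single hv => exact ⟨_, .single hv⟩
  | @cons a b c h k l m w hv hp _ ih =>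
    obtain ⟨w', hw'⟩ := ih
    by_cases hc : k = true ∧ l = true
    · by_cases hb : b ∈ E
      · exact ⟨_, .cons hv ⟨fun _ => hb, fun e => absurd hc e⟩ hw'⟩
      · obtain hb' | ⟨e, he, hbe⟩ := hp.1 hc
        · exact absurd hb' hb
        · obtain ⟨e', he', u, hu⟩ := exists_of_anc (P := (· ∈ E)) hbe he
          obtain ⟨v, hv'⟩ := hu.symm hK
          exact ⟨_, .cons hv ⟨by simp, fun _ => hb⟩
            ((hu.append ⟨fun _ => he', by simp⟩ hv').append ⟨by simp, fun _ => hb⟩ hw')⟩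
    · exact ⟨_, .cons hv ⟨fun e => absurd e hc, hp.2⟩ hw'⟩

/-- Either the non-colliders satisfy a further condition or the walk splits at a node that
does not. -/
lemma refine_or_split (hw : Walk K P Q a h w b k) :
    Walk K P Q' a h w b k ∨ ∃ w₁ w₂ c l m, Walk K P Q a h w₁ c l ∧ Walk K P Q c m w₂ b k ∧
      w₁.length < w.length ∧ w₂.length < w.length ∧ Q c ∧ ¬ Q' c := by
  induction hw with
  | single hv => exact .inl (.single hv)
  | @cons a b c h k l m w hv hp hw ih =>
    by_cases hp' : Passes P Q' b k l
    · rcases ih with hw' | ⟨w₁, w₂, d, l', m', h₁, h₂, hl₁, hl₂, hd⟩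
      · exact .inl (.cons hv hp' hw')
      · refine .inr ⟨_, w₂, d, l', m', .cons hv hp h₁, h₂, ?_, ?_, hd⟩ <;>
          simp only [List.length_cons] <;> omega
    · have hc : ¬ (k = true ∧ l = true) := fun e => hp' ⟨hp.1, fun e' => absurd e e'⟩
      refine .inr ⟨_, w, b, k, l, .single hv, hw, ?_, ?_, hp.2 hc,
        fun e => hp' ⟨hp.1, fun _ => e⟩⟩
      · have := hw.length_pos
        simp only [List.length_cons, List.length_nil]
        omega
      · simp

/-- A walk splits at every inner node. -/
lemma split_of_mem (hw : Walk K P Q a h w b k) {x : V} (hx : x ∈ w.map Step.tgt) :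
    x = b ∨ ∃ w₁ w₂ l m, Walk K P Q a h w₁ x l ∧ Passes P Q x l m ∧ Walk K P Q x m w₂ b k ∧
      w₁.length + w₂.length = w.length := by
  induction hw with
  | single hv => simp at hx; exact .inl hx
  | @cons a b c h k l m w hv hp hw ih =>
    simp only [List.map_cons, List.mem_cons] at hx
    rcases hx with rfl | hx
    · exact .inr ⟨_, w, k, l, .single hv, hp, hw, by simp [Nat.add_comm]⟩
    · rcases ih hx with rfl | ⟨w₁, w₂, l', m', h₁, hp', h₂, hl⟩
      · exact .inl rfl
      · exact .inr ⟨_, w₂, l', m', .cons hv hp h₁, hp', h₂, by simp; omega⟩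

/-- A walk with a repeated node after its start is shortened by cutting at its end point or
contains an inner closed walk. -/
lemma exists_loop (hw : Walk K P Q a h w b k) (hn : ¬ (w.map Step.tgt).Nodup) :
    (∃ w' k', Walk K P Q a h w' b k' ∧ w'.length < w.length) ∨
    ∃ t w₁ w₂ w₃ k₁ l₁ k₂ l₂, Walk K P Q a h w₁ t k₁ ∧ Passes P Q t k₁ l₁ ∧
      Walk K P Q t l₁ w₂ t k₂ ∧ Passes P Q t k₂ l₂ ∧ Walk K P Q t l₂ w₃ b k ∧
      w₁.length + w₃.length < w.length := by
  induction hw with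
  | single hv => simp at hn
  | @cons a b c h k l m w hv hp hw ih =>
    by_cases hb : b ∈ w.map Step.tgt
    · rcases hw.split_of_mem hb with rfl | ⟨w₁, w₂, l', m', h₁, hp', h₂, hl⟩
      · refine .inl ⟨_, k, .single hv, ?_⟩
        have := hw.length_pos
        simp only [List.length_cons, List.length_nil]
        omega
      · refine .inr ⟨b, _, w₁, w₂, k, l, l', m', .single hv, hp, h₁, hp', h₂, ?_⟩
        have := h₁.length_pos
        simp only [List.length_cons, List.length_nil]
        omega
    · have hn' : ¬ (w.map Step.tgt).Nodup := fun e => hn (by simpa using ⟨by simpa using hb, e⟩)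
      rcases ih hn' with ⟨w', k', hw', hl⟩ |
        ⟨t, w₁, w₂, w₃, k₁, l₁, k₂, l₂, h₁, p₁, h₂, p₂, h₃, hl⟩
      · exact .inl ⟨_, k', .cons hv hp hw', by simpa using hl⟩
      · exact .inr ⟨t, _, w₂, w₃, k₁, l₁, k₂, l₂, .cons hv hp h₁, p₁, h₂, p₂, h₃,
          by simp; omega⟩

lemma exists_shorter (hK : NoHeadAtLine K) (hab : a ≠ b)
    (hw : Walk K (· ∈ E ∪ K.anSet E) (· ∉ E) a h w b k)
    (hn : ¬ (a :: w.map Step.tgt).Nodup) :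
    ∃ w' h' k', Walk K (· ∈ E ∪ K.anSet E) (· ∉ E) a h' w' b k' ∧ w'.length < w.length := by
  by_cases ha : a ∈ w.map Step.tgt
  · rcases hw.split_of_mem ha with rfl | ⟨w₁, w₂, l, m, h₁, -, h₂, hl⟩
    · exact absurd rfl hab
    · exact ⟨w₂, m, k, h₂, by have := h₁.length_pos; omega⟩
  · rcases hw.exists_loop fun e => hn (List.nodup_cons.2 ⟨ha, e⟩) with ⟨w', k', hw', hl⟩ |
      ⟨t, w₁, w₂, w₃, k₁, l₁, k₂, l₂, h₁, p₁, h₂, p₂, h₃, hl⟩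
    · exact ⟨w', h, k', hw', hl⟩
    · refine ⟨w₁ ++ w₃, h, k, h₁.append (l := l₂) ⟨?_, fun hc => ?_⟩ h₃, by simpa using hl⟩
      · rintro ⟨rfl, rfl⟩
        cases l₁
        · cases k₂
          · rcases h₂.line_or_anc hK with hl | ht | ⟨hf, -⟩
            · exact absurd h₁.hasHead (hK t hl)
            · exact .inr ht
            · cases hf
          · exact p₂.1 ⟨rfl, rfl⟩
        · exact p₁.1 ⟨rfl, rfl⟩
      · by_cases hk : k₁ = true
        · exact p₂.2 fun e => hc ⟨hk, e.2⟩
        · exact p₁.2 fun e => hk e.1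

lemma src_ne_tgt (hw : Walk K P Q a h w b k) (hn : (a :: w.map Step.tgt).Nodup) :
    ∀ s ∈ w, s.src ≠ s.tgt := by
  induction hw with
  | single hv => simpa using hn
  | cons hv hp hw ih =>
    simp only [List.map_cons] at hn
    intro s hs
    rcases List.mem_cons.1 hs with rfl | hs
    · exact fun e => (List.nodup_cons.1 hn).1 (by simp only at e; simp [e])
    · exact ih (List.nodup_cons.1 hn).2 s hs

lemma valid (hw : Walk K P Q a h w b k) : ∀ s ∈ w, s.valid K := by
  induction hw with
  | single hv => simpa using hv
  | cons hv hp hw ih => exact List.forall_mem_cons.2 ⟨hv, ih⟩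

lemma isPath (hw : Walk K P Q a h w b k) (hn : (a :: w.map Step.tgt).Nodup) :
    IsPath K a b w := by
  refine ⟨List.ne_nil_of_length_pos hw.length_pos, hw.valid, ?_, ?_, ?_, hn⟩
  · clear hn
    induction hw with
    | single hv => exact .singleton _
    | cons hv hp hw ih => cases hw <;> exact .cons_cons rfl ih
  · cases hw <;> rfl
  · clear hn
    induction hw with
    | single hv => rfl
    | cons hv hp hw ih =>
      cases hw
      · rfl
      · simpa using ih

lemma mConnPath {M : Set V} (hw : Walk K (· ∈ E ∪ K.anSet E) (· ∈ M) a h w b k) :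
    MConnPath K M E w := by
  induction hw with
  | single hv => exact .singleton _
  | cons hv hp hw ih => cases hw <;> exact .cons_cons hp ih

/-- A walk that is open given `E` between two sets yields an m-connecting path between them. -/
lemma exists_path (hK : K.Wf) (hl : NoHeadAtLine K) {A B : Set V} (hAB : Disjoint A B)
    (ha : a ∈ A) (hb : b ∈ B) (hw : Walk K (· ∈ E ∪ K.anSet E) (· ∉ E) a h w b k) :
    ∃ i ∈ A, ∃ j ∈ B, ∃ w, IsPath K i j w ∧ MConnPath K (K.nodes \ (A ∪ B ∪ E)) E w ∧
      ∀ s ∈ w, s.src ≠ s.tgt := by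
  induction hn : w.length using Nat.strong_induction_on generalizing a b h k w with
  | _ n ih =>
    subst hn
    by_cases hd : (a :: w.map Step.tgt).Nodup
    · rcases hw.refine_or_split (Q' := (· ∈ K.nodes \ (A ∪ B ∪ E))) with hw' |
        ⟨w₁, w₂, c, l, m, h₁, h₂, hl₁, hl₂, hc, hc'⟩
      · exact ⟨a, ha, b, hb, w, hw.isPath hd, hw'.mConnPath, hw.src_ne_tgt hd⟩
      · have hc'' : c ∈ A ∨ c ∈ B := by
          by_contra hcon
          exact hc' ⟨h₂.mem_nodes_left hK, by rintro (hx | hx); exacts [hcon hx, hc hx]⟩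
        rcases hc'' with hcA | hcB
        · exact ih _ hl₂ hcA hb h₂ rfl
        · exact ih _ hl₁ ha hcB h₁ rfl
    · obtain ⟨w', h', k', hw', hlt⟩ :=
        hw.exists_shorter hl (hAB.ne_of_mem ha hb) hd
      exact ih _ hlt ha hb hw' rfl

end Walk

/-- An m-connecting path is a walk that is open given `E`. -/
lemma exists_walk_of_path {M : Set V} (hp : IsPath K a b w) (hm : MConnPath K M E w) :
    ∃ h k, Walk K (· ∈ E ∪ K.anSet E) (· ∈ M) a h w b k := by
  obtain ⟨h0, hv, hc, hh, ht, -⟩ := hp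
  induction w generalizing a with
  | nil => exact absurd rfl h0
  | cons s w ih =>
    obtain rfl : s.src = a := by simpa using hh
    have hs : s.valid K := hv s (by simp)
    cases w with
    | nil =>
      obtain rfl : s.tgt = b := by simpa using ht
      exact ⟨s.hs, s.ht, .single hs⟩
    | cons t w =>
      replace hm := List.isChain_cons_cons.1 hm
      replace hc := List.isChain_cons_cons.1 hc
      obtain ⟨h, k, hw⟩ := ih (a := s.tgt) hm.2 (by simp)
        (fun x hx => hv x (List.mem_cons_of_mem _ hx)) hc.2 (by simp [hc.1]) (by simpa using ht)
      have : h = t.hs := by cases hw <;> rfl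
      subst this
      exact ⟨s.hs, k, .cons hs hm.1 hw⟩

end

/-! ### The graph generated by marginalisation and conditioning -/

/-- Endpoint marks of edges generated by the walks of `G` with inner non-colliders in `M` and
inner colliders in `C ∪ an(C)`; arrowheads at `an(C)` are removed. -/
def GenEdge (G : MixedGraph V) (M C : Set V) (a : V) (h : Bool) (b : V) (k : Bool) : Prop :=
  a ∈ G.nodes \ (M ∪ C) ∧ b ∈ G.nodes \ (M ∪ C) ∧ ∃ w h' k',
    Walk G (· ∈ C ∪ G.anSet C) (· ∈ M) a h' w b k' ∧
    (h = true ↔ h' = true ∧ a ∉ G.anSet C) ∧ (k = true ↔ k' = true ∧ b ∉ G.anSet C)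

/-- The mixed graph of generated edges, which may have loops. -/
def walkGraph (G : MixedGraph V) (M C : Set V) : MixedGraph V where
  nodes := G.nodes \ (M ∪ C)
  arrow a b := GenEdge G M C a false b true
  arc a b := GenEdge G M C a true b true
  line a b := GenEdge G M C a false b false

/-- The mixed graph with loops at arcs and lines removed. -/
def dropLoops (K : MixedGraph V) : MixedGraph V where
  nodes := K.nodes
  arrow := K.arrow
  arc a b := K.arc a b ∧ a ≠ b
  line a b := K.line a b ∧ a ≠ b

lemma valid_of_dropLoops {K : MixedGraph V} {s : Step V} (hs : s.valid (dropLoops K)) :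
    s.valid K := by
  obtain ⟨a, b, h, k⟩ := s
  cases h <;> cases k <;> simp only [Step.valid, dropLoops] at hs ⊢
  exacts [hs.1, hs, hs, hs.1]

lemma valid_dropLoops {K : MixedGraph V} {s : Step V} (hs : s.valid K) (hne : s.src ≠ s.tgt) :
    s.valid (dropLoops K) := by
  obtain ⟨a, b, h, k⟩ := s
  cases h <;> cases k <;> simp only [Step.valid, dropLoops] at hs ⊢
  exacts [⟨hs, hne⟩, hs, hs, ⟨hs, hne⟩]

/-- m-separation after dropping loops is the absence of open walks. -/
lemma mSep_dropLoops_iff {K : MixedGraph V} (hK : K.Wf) (hl : NoHeadAtLine K) {A B E : Set V}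
    (hAB : Disjoint A B) :
    MSep (dropLoops K) A B E ↔ ∀ i ∈ A, ∀ j ∈ B, ∀ h k w,
      ¬ Walk K (· ∈ E ∪ K.anSet E) (· ∉ E) i h w j k := by
  constructor
  · intro hs i hi j hj h k w hw
    obtain ⟨i, hi, j, hj, w, ⟨h0, hv, hp⟩, hm, hne⟩ := hw.exists_path hK hl hAB hi hj
    exact hs i hi j hj w ⟨h0, fun s hs => valid_dropLoops (hv s hs) (hne s hs), hp⟩ hm
  · rintro hs i hi j hj w ⟨h0, hv, hp⟩ hm
    obtain ⟨h, k, hw⟩ := exists_walk_of_path (K := K)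
      ⟨h0, fun s hs => valid_of_dropLoops (hv s hs), hp⟩ hm
    exact hs i hi j hj h k w (hw.mono (fun _ => id) fun x hx hE => hx.2 (.inr hE))

lemma dropLoops_eq_self {K : MixedGraph V} (hK : K.Loopless) : dropLoops K = K := by
  obtain ⟨N, ar, ac, li⟩ := K
  simp only [dropLoops, MixedGraph.mk.injEq, true_and]
  constructor <;> funext a b <;> refine propext ⟨And.left, fun h => ⟨h, ?_⟩⟩ <;> rintro rfl
  exacts [(hK a).2.1 h, (hK a).2.2 h]

section

variable {G : MixedGraph V} {M C D : Set V} {a b : V} {h k : Bool} {w : List (Step V)}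

lemma valid_walkGraph_iff (hG : G.Wf) :
    Step.valid (walkGraph G M C) ⟨a, b, h, k⟩ ↔ GenEdge G M C a h b k := by
  cases h <;> cases k <;> simp only [Step.valid, walkGraph]
  constructor <;> rintro ⟨ha, hb, w, h', k', hw, hh, hk⟩ <;> obtain ⟨w', hw'⟩ := hw.symm hG <;>
    exact ⟨hb, ha, w', k', h', hw', hk, hh⟩

lemma wf_walkGraph (hG : G.Wf) : (walkGraph G M C).Wf := by
  refine ⟨?_, ?_, ?_⟩
  · rintro i j ⟨ha, hb, w, h', k', hw, hh, hk⟩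
    obtain ⟨w', hw'⟩ := hw.symm hG
    exact ⟨hb, ha, w', k', h', hw', hk, hh⟩
  · rintro i j ⟨ha, hb, w, h', k', hw, hh, hk⟩
    obtain ⟨w', hw'⟩ := hw.symm hG
    exact ⟨hb, ha, w', k', h', hw', hk, hh⟩
  · rintro i j (⟨ha, hb, -⟩ | ⟨ha, hb, -⟩ | ⟨ha, hb, -⟩) <;> exact ⟨ha, hb⟩

lemma GenEdge.head (he : GenEdge G M C a h b true) : HasHead G b ∧ b ∉ G.anSet C := by
  obtain ⟨-, -, w, h', k', hw, -, hk⟩ := he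
  obtain ⟨rfl, hb⟩ := hk.1 rfl
  exact ⟨hw.hasHead, hb⟩

lemma hasHead_of_walkGraph (hd : HasHead (walkGraph G M C) b) : HasHead G b ∧ b ∉ G.anSet C := by
  obtain ⟨a, he | he⟩ := hd <;> exact GenEdge.head he

/-- A generated edge with a tail at a node that has an arrowhead and is no ancestor of `C`
is an arrow from an ancestor. -/
lemma GenEdge.anc (hG : NoHeadAtLine G) (he : GenEdge G M C a false b k) (ha : HasHead G a)
    (haC : a ∉ G.anSet C) : k = true ∧ G.anc a b := by
  obtain ⟨-, -, w, h', k', hw, hh, hk⟩ := he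
  have : h' = false := by
    cases h'
    · rfl
    · exact absurd (hh.2 ⟨rfl, haC⟩) (by simp)
  subst this
  rcases hw.line_or_anc hG with hl | hc | ⟨rfl, hab⟩
  · exact absurd ha (hG a hl)
  · exact absurd hc haC
  · refine ⟨hk.2 ⟨rfl, ?_⟩, hab⟩
    rintro ⟨c, hc, hbc⟩
    exact haC ⟨c, hc, hab.trans hbc⟩

lemma noHeadAtLine_walkGraph (hG : NoHeadAtLine G) : NoHeadAtLine (walkGraph G M C) := by
  rintro i ⟨j, hl⟩ hd
  obtain ⟨hi, hiC⟩ := hasHead_of_walkGraph hd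
  exact absurd (GenEdge.anc hG hl hi hiC).1 (by simp)

lemma anc_of_walkGraph (hG : NoHeadAtLine G) (hab : (walkGraph G M C).anc a b)
    (ha : HasHead G a) (haC : a ∉ G.anSet C) : G.anc a b := by
  induction hab with
  | single he => exact (GenEdge.anc hG he ha haC).2
  | tail _ he ih =>
    refine ih.trans (GenEdge.anc hG he ?_ ?_).2
    · obtain ⟨x, -, hx⟩ := Relation.TransGen.tail'_iff.1 ih
      exact ⟨x, .inl hx⟩
    · rintro ⟨c, hc, hbc⟩
      exact haC ⟨c, hc, ih.trans hbc⟩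

lemma not_anc_self_walkGraph (hG : NoHeadAtLine G) (hacyc : ∀ i, ¬ G.anc i i) (i : V) :
    ¬ (walkGraph G M C).anc i i := by
  intro hi
  obtain ⟨x, -, hx⟩ := Relation.TransGen.tail'_iff.1 hi
  obtain ⟨h1, h2⟩ := hasHead_of_walkGraph ⟨x, .inl hx⟩
  exact hacyc i (anc_of_walkGraph hG hi h1 h2)

lemma isSG_dropLoops_walkGraph (hG : G.IsSG) : (dropLoops (walkGraph G M C)).IsSG := by
  obtain ⟨⟨hwf, -, hfin⟩, hl, hacyc⟩ := hG
  have hl' : NoHeadAtLine G := fun i hi ⟨c, hc⟩ => hc.elim (hl i hi c).1 (hl i hi c).2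
  have hwf' := wf_walkGraph (M := M) (C := C) hwf
  have hac := not_anc_self_walkGraph (M := M) (C := C) hl' hacyc
  refine ⟨⟨⟨fun i j hij => ⟨hwf'.1 _ _ hij.1, hij.2.symm⟩,
    fun i j hij => ⟨hwf'.2.1 _ _ hij.1, hij.2.symm⟩, ?_⟩,
    fun i => ⟨fun e => hac i (.single e), fun e => e.2 rfl, fun e => e.2 rfl⟩,
    hfin.subset Set.sdiff_subset⟩, ?_, hac⟩
  · rintro i j (e | e | e)
    exacts [hwf'.2.2 i j (.inl e), hwf'.2.2 i j (.inr (.inl e.1)),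
      hwf'.2.2 i j (.inr (.inr e.1))]
  · rintro i ⟨j, hj⟩ x
    have := noHeadAtLine_walkGraph (M := M) (C := C) hl' i ⟨j, hj.1⟩
    exact ⟨fun e => this ⟨x, .inl e⟩, fun e => this ⟨x, .inr e.1⟩⟩

lemma anSet_mono {S T : Set V} (hST : S ⊆ T) : G.anSet S ⊆ G.anSet T :=
  fun _ ⟨c, hc, hac⟩ => ⟨c, hST hc, hac⟩

/-- Open walks of the generated graph expand to open walks of the original graph. -/
lemma expand_walk (hG : G.Wf) (hMC : Disjoint M C) (hDM : Disjoint D M)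
    (hw : Walk (walkGraph G M C) (· ∈ D) (· ∉ D) a h w b k) :
    ∃ w' h' k', Walk G (· ∈ (D ∪ C) ∪ G.anSet (D ∪ C)) (· ∉ D ∪ C) a h' w' b k' ∧
      (h = true ↔ h' = true ∧ a ∉ G.anSet C) := by
  have hP : ∀ x, x ∈ C ∪ G.anSet C → x ∈ (D ∪ C) ∪ G.anSet (D ∪ C) :=
    fun x hx => hx.imp .inr fun e => anSet_mono Set.subset_union_right e
  have hQ : ∀ x, x ∈ M → x ∉ D ∪ C := fun x hx e =>
    e.elim (fun e => hDM.ne_of_mem e hx rfl) fun e => hMC.ne_of_mem hx e rfl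
  induction hw with
  | single hv =>
    obtain ⟨-, -, w', h', k', hw', hh, -⟩ := (valid_walkGraph_iff hG).1 hv
    exact ⟨w', h', k', hw'.mono hP hQ, hh⟩
  | @cons a b c h k l m w hv hp _ ih =>
    obtain ⟨-, hb, w₁, h', k', h₁, hh, hk⟩ := (valid_walkGraph_iff hG).1 hv
    obtain ⟨w₂, l', m', h₂, hl⟩ := ih
    refine ⟨_, h', m', (h₁.mono hP hQ).append (l := l') ⟨?_, fun hc => ?_⟩ h₂, hh⟩
    · rintro ⟨ek, el⟩
      by_cases hbC : b ∈ G.anSet C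
      · exact hP b (.inr hbC)
      · exact .inl (.inl (hp.1 ⟨hk.2 ⟨ek, hbC⟩, hl.2 ⟨el, hbC⟩⟩))
    · rintro (e | e)
      · exact hp.2 (fun e' => hc ⟨(hk.1 e'.1).1, (hl.1 e'.2).1⟩) e
      · exact hb.2 (.inr e)

lemma exists_mark (p : Prop) : ∃ m : Bool, m = true ↔ p := by
  by_cases hp : p
  · exact ⟨true, by simpa⟩
  · exact ⟨false, by simpa⟩

/-- Open walks of the original graph contract to open walks of the generated graph. -/
lemma contract_walk (hG : G.Wf) (hMC : Disjoint M C) (hDM : Disjoint D M)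
    (hb : b ∈ G.nodes \ (M ∪ C)) (hw : Walk G (· ∈ D ∪ C) (· ∉ D ∪ C) a h w b k) :
    (∃ w', Walk G (· ∈ C ∪ G.anSet C) (· ∈ M) a h w' b k) ∨
    ∃ c ∈ G.nodes \ (M ∪ C), ∃ w₁ w₂ k₁ l₁ k₁' m,
      Walk G (· ∈ C ∪ G.anSet C) (· ∈ M) a h w₁ c k₁ ∧
      (k₁' = true ↔ k₁ = true ∧ c ∉ G.anSet C) ∧ Passes (· ∈ D) (· ∉ D) c k₁' l₁ ∧
      Walk (walkGraph G M C) (· ∈ D) (· ∉ D) c l₁ w₂ b m := by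
  induction hw with
  | single hv => exact .inl ⟨_, .single hv⟩
  | @cons a c b h k l m w hv hp hw ih =>
    have hcn := hw.mem_nodes_left hG
    by_cases hext : Passes (· ∈ C ∪ G.anSet C) (· ∈ M) c k l
    · rcases ih hb with ⟨w', hw'⟩ | ⟨d, hd, w₁, w₂, k₁, l₁, k₁', m', h₁, hk, hp', h₂⟩
      · exact .inl ⟨_, .cons hv hext hw'⟩
      · exact .inr ⟨d, hd, _, w₂, k₁, l₁, k₁', m', .cons hv hext h₁, hk, hp', h₂⟩
    · have hcN : c ∈ G.nodes \ (M ∪ C) := by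
        refine ⟨hcn, ?_⟩
        rintro (hc | hc)
        · refine hext ⟨fun e => ?_, fun _ => hc⟩
          rcases hp.1 e with hcD | hcC
          · exact absurd rfl (hDM.ne_of_mem hcD hc)
          · exact absurd rfl (hMC.ne_of_mem hc hcC)
        · exact hext ⟨fun _ => .inl hc, fun e => absurd (.inr hc) (hp.2 e)⟩
      obtain ⟨k', hk'⟩ := exists_mark (k = true ∧ c ∉ G.anSet C)
      obtain ⟨l', hl'⟩ := exists_mark (l = true ∧ c ∉ G.anSet C)
      have hp' : Passes (· ∈ D) (· ∉ D) c k' l' := by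
        refine ⟨fun e => ?_, fun e hcD => ?_⟩
        · rcases hp.1 ⟨(hk'.1 e.1).1, (hl'.1 e.2).1⟩ with hcD | hcC
          · exact hcD
          · exact absurd (.inr hcC) hcN.2
        · by_cases hkl : k = true ∧ l = true
          · refine hext ⟨fun _ => .inr ?_, fun e' => absurd hkl e'⟩
            by_contra hcC
            exact e ⟨hk'.2 ⟨hkl.1, hcC⟩, hl'.2 ⟨hkl.2, hcC⟩⟩
          · exact hp.2 hkl (.inl hcD)
      refine .inr ⟨c, hcN, [⟨a, c, h, k⟩], ?_⟩
      rcases ih hb with ⟨w', hw'⟩ | ⟨d, hd, w₁, w₂, k₁, l₁, k₁', m', h₁, hk, hq, h₂⟩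
      · obtain ⟨m', hm'⟩ := exists_mark (m = true ∧ b ∉ G.anSet C)
        exact ⟨_, k, l', k', m', .single hv, hk', hp',
          .single ((valid_walkGraph_iff hG).2 ⟨hcN, hb, w', l, m, hw', hl', hm'⟩)⟩
      · exact ⟨_, k, l', k', m', .single hv, hk', hp',
          .cons ((valid_walkGraph_iff hG).2 ⟨hcN, hd, w₁, l, k₁, h₁, hl', hk⟩) hq h₂⟩

/-- Nodes of the generated graph are joined by an open walk given `D` iff they are joined in the
original graph by an open walk given `D ∪ C`. -/
lemma exists_walk_walkGraph_iff (hG : G.Wf) (hMC : Disjoint M C) (hDM : Disjoint D M)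
    (ha : a ∈ G.nodes \ (M ∪ C)) (hb : b ∈ G.nodes \ (M ∪ C)) :
    (∃ h k w, Walk (walkGraph G M C) (· ∈ D ∪ (walkGraph G M C).anSet D) (· ∉ D) a h w b k) ↔
      ∃ h k w, Walk G (· ∈ (D ∪ C) ∪ G.anSet (D ∪ C)) (· ∉ D ∪ C) a h w b k := by
  constructor
  · rintro ⟨h, k, w, hw⟩
    obtain ⟨w₁, h₁⟩ := hw.detour (wf_walkGraph hG)
    obtain ⟨w', h', k', hw', -⟩ := expand_walk hG hMC hDM h₁
    exact ⟨h', k', w', hw'⟩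
  · rintro ⟨h, k, w, hw⟩
    obtain ⟨w₁, h₁⟩ := hw.detour hG
    obtain ⟨h', hh⟩ := exists_mark (h = true ∧ a ∉ G.anSet C)
    rcases contract_walk hG hMC hDM hb h₁ with ⟨w', hw'⟩ |
      ⟨c, hc, w', w₂, k₁, l₁, k₁', m, hw', hk, hp, h₂⟩
    · obtain ⟨k', hk⟩ := exists_mark (k = true ∧ b ∉ G.anSet C)
      exact ⟨h', k', _, .single ((valid_walkGraph_iff hG).2 ⟨ha, hb, w', h, k, hw', hh, hk⟩)⟩
    · exact ⟨h', m, _, .cons ((valid_walkGraph_iff hG).2 ⟨ha, hc, w', h, k₁, hw', hh, hk⟩)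
        (hp.mono (fun _ => .inl) fun _ => id) (h₂.mono (fun _ => .inl) fun _ => id)⟩

end

/-- (Corollary 5) The class of summary graphs is stable
under marginalisation and conditioning. -/
theorem stmt_14 {V : Type} (G : MixedGraph V) (M C : Set V)
    (hG : G.IsSG) (hM : M ⊆ G.nodes) (hC : C ⊆ G.nodes) (hMC : Disjoint M C) :
    ∃ H : MixedGraph V, H.IsSG ∧ H.nodes = G.nodes \ (M ∪ C) ∧
      Jm H = alphaIM (Jm G) M C := by
  refine ⟨dropLoops (walkGraph G M C), isSG_dropLoops_walkGraph hG, rfl, ?_⟩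
  obtain ⟨⟨hwf, hloop, -⟩, hl, -⟩ := hG
  have hl' : NoHeadAtLine G := fun i hi ⟨c, hc⟩ => hc.elim (hl i hi c).1 (hl i hi c).2
  have key : ∀ {A B D : Set V}, A ⊆ G.nodes \ (M ∪ C) → B ⊆ G.nodes \ (M ∪ C) →
      D ⊆ G.nodes \ (M ∪ C) → Disjoint A B →
      (MSep (dropLoops (walkGraph G M C)) A B D ↔ MSep G A B (D ∪ C)) := by
    intro A B D hA hB hD hAB
    have hDM : Disjoint D M := Set.disjoint_left.2 fun x hx hxM => (hD hx).2 (.inl hxM)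
    rw [mSep_dropLoops_iff (wf_walkGraph hwf) (noHeadAtLine_walkGraph hl') hAB,
      ← dropLoops_eq_self hloop, mSep_dropLoops_iff hwf hl' hAB, dropLoops_eq_self hloop]
    refine forall₂_congr fun i hi => forall₂_congr fun j hj => ?_
    have := exists_walk_walkGraph_iff hwf hMC hDM (hA hi) (hB hj)
    simpa only [not_exists] using not_congr this
  ext ⟨A, B, D⟩
  constructor
  · rintro ⟨hA, hB, hD, hAB, hAD, hBD, hs⟩
    have hdisj : ∀ {S : Set V}, S ⊆ G.nodes \ (M ∪ C) → Disjoint S (M ∪ C) :=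
      fun hS => Set.disjoint_left.2 fun x hx => (hS hx).2
    refine ⟨⟨hA.trans Set.sdiff_subset, hB.trans Set.sdiff_subset,
      Set.union_subset (hD.trans Set.sdiff_subset) hC, hAB,
      hAD.union_right ((hdisj hA).mono_right Set.subset_union_right),
      hBD.union_right ((hdisj hB).mono_right Set.subset_union_right),
      (key hA hB hD hAB).1 hs⟩, ?_⟩
    exact (((hdisj hA).union_left (hdisj hB)).union_left (hdisj hD)).inter_eq
  · rintro ⟨⟨hA, hB, hD, hAB, hAD, hBD, hs⟩, he⟩
    have hdisj : Disjoint (A ∪ B ∪ D) (M ∪ C) := Set.disjoint_iff_inter_eq_empty.2 he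
    rw [Set.disjoint_union_left, Set.disjoint_union_left] at hdisj
    obtain ⟨⟨hA', hB'⟩, hD'⟩ := hdisj
    have hA'' := Set.subset_sdiff.2 ⟨hA, hA'⟩
    have hB'' := Set.subset_sdiff.2 ⟨hB, hB'⟩
    have hD'' := Set.subset_sdiff.2 ⟨Set.subset_union_left.trans hD, hD'⟩
    exact ⟨hA'', hB'', hD'', hAB, hAD.mono_right Set.subset_union_left,
      hBD.mono_right Set.subset_union_left, (key hA'' hB'' hD'' hAB).2 hs⟩

end StableMixedGraphs
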